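/- arXiv:1611.03917 — 3 statements merged into one kernel-verified Lean document; each statement's English description precedes it below -/
import Mathlib

section
/- For every real number ε with 0 < ε < 1 and every σ > 0, setting δ = exp(−1/ε), there exists a twice continuously differentiable function θ : ℝ → ℝ such that 0 ≤ θ(r) ≤ 1 for all r, θ(r) = 1 for all r ≤ σ + δ²/2, θ(r) = 0 for all r ≥ σ + δ + δ²/2, and |θ′(r)| ≤ ε/(r − σ) for all r > σ. -/
/-- Hopf's logarithmic cut-off construction: for every `0 < ε < 1` and `σ > 0`,
with `δ = exp (-1/ε)`, there is a `C²` cut-off `θ` with values in `[0,1]`,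
equal to `1` for `r ≤ σ + δ²/2`, equal to `0` for `r ≥ σ + δ + δ²/2`, and
whose derivative satisfies `|θ'(r)| ≤ ε/(r - σ)` for all `r > σ`. -/
theorem hopf_cutoff_exists (ε σ : ℝ) (hε : 0 < ε) (hε1 : ε < 1) (hσ : 0 < σ)
    (δ : ℝ) (hδ : δ = Real.exp (-1 / ε)) :
    ∃ θ : ℝ → ℝ, ContDiff ℝ 2 θ ∧
      (∀ r, 0 ≤ θ r ∧ θ r ≤ 1) ∧
      (∀ r, r ≤ σ + δ ^ 2 / 2 → θ r = 1) ∧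
      (∀ r, σ + δ + δ ^ 2 / 2 ≤ r → θ r = 0) ∧
      (∀ r, σ < r → |deriv θ r| ≤ ε / (r - σ)) := by
  have hδ0 : 0 < δ := hδ ▸ Real.exp_pos _
  have hlog : Real.log δ = -1 / ε := by rw [hδ, Real.log_exp]
  have hd : 0 < δ ^ 2 / 2 := by positivity
  obtain ⟨χ, hχs, hχ0, hχ1, hχa, hχb, hχm⟩ : ∃ χ : ℝ → ℝ, ContDiff ℝ 1 χ ∧ (∀ s, 0 ≤ χ s) ∧
      (∀ s, χ s ≤ 1) ∧ (∀ s, s ≤ δ ^ 2 / 2 → χ s = 0) ∧ (∀ s, δ + δ ^ 2 / 2 ≤ s → χ s = 0) ∧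
      (∀ s, δ ^ 2 ≤ s → s ≤ δ → χ s = 1) := by
    refine ⟨fun s => Real.smoothTransition ((s - δ ^ 2 / 2) / (δ ^ 2 / 2)) *
      Real.smoothTransition ((δ + δ ^ 2 / 2 - s) / (δ ^ 2 / 2)), ?_, ?_, ?_, ?_, ?_, ?_⟩
    · have h : ContDiff ℝ 1 Real.smoothTransition := Real.smoothTransition.contDiff (n := 1)
      exact (h.comp (by fun_prop)).mul (h.comp (by fun_prop))
    · intro s
      exact mul_nonneg (Real.smoothTransition.nonneg _) (Real.smoothTransition.nonneg _)
    · intro s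
      exact mul_le_one₀ (Real.smoothTransition.le_one _) (Real.smoothTransition.nonneg _)
        (Real.smoothTransition.le_one _)
    · intro s hs
      have := Real.smoothTransition.zero_of_nonpos
        (div_nonpos_of_nonpos_of_nonneg (sub_nonpos.2 hs) hd.le)
      simp only [this, zero_mul]
    · intro s hs
      have := Real.smoothTransition.zero_of_nonpos
        (div_nonpos_of_nonpos_of_nonneg (sub_nonpos.2 hs) hd.le)
      simp only [this, mul_zero]
    · intro s h1 h2
      have e1 : 1 ≤ (s - δ ^ 2 / 2) / (δ ^ 2 / 2) := by rw [le_div_iff₀ hd]; linarith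
      have e2 : 1 ≤ (δ + δ ^ 2 / 2 - s) / (δ ^ 2 / 2) := by rw [le_div_iff₀ hd]; linarith
      simp only [Real.smoothTransition.one_of_one_le e1, Real.smoothTransition.one_of_one_le e2,
        mul_one]
  obtain ⟨g, hg⟩ : ∃ g : ℝ → ℝ, g = fun s => ε * s⁻¹ * χ s := ⟨_, rfl⟩
  have hga : ∀ s, s ≤ δ ^ 2 / 2 → g s = 0 := fun s hs => by simp [hg, hχa s hs]
  have hgb : ∀ s, δ + δ ^ 2 / 2 ≤ s → g s = 0 := fun s hs => by simp [hg, hχb s hs]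
  have hg0 : ∀ s, 0 ≤ g s := by
    intro s
    rcases le_total s (δ ^ 2 / 2) with h | h
    · rw [hga s h]
    · have : 0 < s := hd.trans_le h
      have := hχ0 s
      rw [hg]; positivity
  have hgle : ∀ s, 0 < s → g s ≤ ε / s := by
    intro s hs
    rw [hg, div_eq_mul_inv]
    exact mul_le_of_le_one_right (by positivity) (hχ1 s)
  have hgs : ContDiff ℝ 1 g := by
    rw [contDiff_iff_contDiffAt]
    intro s
    rcases lt_or_ge s (δ ^ 2 / 2) with h | h
    · have : g =ᶠ[nhds s] fun _ => 0 := by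
        filter_upwards [Iio_mem_nhds h] with x hx using hga x (le_of_lt hx)
      exact contDiffAt_const.congr_of_eventuallyEq this
    · have : s ≠ 0 := (hd.trans_le h).ne'
      rw [hg]
      exact (contDiffAt_const.mul (contDiffAt_inv ℝ this)).mul hχs.contDiffAt
  have hgc : Continuous g := hgs.continuous
  have hint : ∀ a b, IntervalIntegrable g MeasureTheory.volume a b :=
    fun a b => hgc.intervalIntegrable a b
  obtain ⟨G, hG⟩ : ∃ G : ℝ → ℝ, G = fun s => ∫ x in (0:ℝ)..s, g x := ⟨_, rfl⟩
  have hGd : ∀ s, HasDerivAt G (g s) s := by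
    intro s
    rw [hG]
    exact intervalIntegral.integral_hasDerivAt_right (hint _ _)
      hgc.stronglyMeasurable.stronglyMeasurableAtFilter hgc.continuousAt
  have hGdiff : Differentiable ℝ G := fun s => (hGd s).differentiableAt
  have hGderiv : deriv G = g := funext fun s => (hGd s).deriv
  have hGsub : ∀ a b, G b - G a = ∫ x in a..b, g x := by
    intro a b
    rw [hG]
    exact intervalIntegral.integral_interval_sub_left (hint _ _) (hint _ _)
  have hGs : ContDiff ℝ 2 G := by
    have : (2 : WithTop ℕ∞) = 1 + 1 := by norm_num
    rw [this, contDiff_succ_iff_deriv]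
    exact ⟨hGdiff, by simp, hGderiv ▸ hgs⟩
  have hGm : Monotone G := monotone_of_deriv_nonneg hGdiff (by rw [hGderiv]; exact hg0)
  have hGa : ∀ s, s ≤ δ ^ 2 / 2 → G s = 0 := by
    intro s hs
    rw [hG]
    have : ∫ x in (0:ℝ)..s, g x = ∫ x in (0:ℝ)..s, (0:ℝ) := by
      apply intervalIntegral.integral_congr
      intro x hx
      exact hga x (hx.2.trans (max_le hd.le hs))
    simpa using this
  obtain ⟨I, hI⟩ : ∃ I, I = G (δ + δ ^ 2 / 2) := ⟨_, rfl⟩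
  have hGb : ∀ s, δ + δ ^ 2 / 2 ≤ s → G s = I := by
    intro s hs
    have : ∫ x in (δ + δ ^ 2 / 2)..s, g x = ∫ x in (δ + δ ^ 2 / 2)..s, (0:ℝ) := by
      apply intervalIntegral.integral_congr
      intro x hx
      rw [Set.uIcc_of_le hs] at hx
      exact hgb x hx.1
    have h2 := hGsub (δ + δ ^ 2 / 2) s
    rw [this] at h2
    simp at h2
    linarith
  have hδ1 : δ < 1 := by
    rw [hδ, Real.exp_lt_one_iff]
    exact div_neg_of_neg_of_pos (by norm_num) hε
  have hδ2 : δ ^ 2 ≤ δ := by nlinarith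
  have hI1 : 1 ≤ I := by
    have h1 : G δ - G (δ ^ 2) = 1 := by
      rw [hGsub]
      have : ∫ x in (δ ^ 2)..δ, g x = ∫ x in (δ ^ 2)..δ, ε * x⁻¹ := by
        apply intervalIntegral.integral_congr
        intro x hx
        rw [Set.uIcc_of_le hδ2] at hx
        simp [hg, hχm x hx.1 hx.2]
      rw [this, intervalIntegral.integral_const_mul, integral_inv_of_pos (by positivity) hδ0,
        Real.log_div hδ0.ne' (by positivity), Real.log_pow, hlog]
      field_simp
      norm_num
    have h2 : 0 ≤ G (δ ^ 2) := by
      rw [← hGa 0 hd.le]; exact hGm (by positivity)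
    have h3 : G δ ≤ I := hI ▸ hGm (by linarith)
    linarith
  have hI0 : 0 < I := by linarith
  have hGn : ∀ s, 0 ≤ G s := by
    intro s
    rcases le_total s (δ ^ 2 / 2) with h | h
    · rw [hGa s h]
    · rw [← hGa _ le_rfl]; exact hGm h
  have hGI : ∀ s, G s ≤ I := by
    intro s
    rcases le_total s (δ + δ ^ 2 / 2) with h | h
    · rw [hI]; exact hGm h
    · rw [hGb s h]
  refine ⟨fun r => 1 - G (r - σ) / I, ?_, ?_, ?_, ?_, ?_⟩
  · exact contDiff_const.sub ((hGs.comp (contDiff_id.sub contDiff_const)).div_const I)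
  · intro r
    have h1 : G (r - σ) / I ≤ 1 := (div_le_one hI0).2 (hGI _)
    have h2 : 0 ≤ G (r - σ) / I := div_nonneg (hGn _) hI0.le
    constructor <;> linarith
  · intro r hr
    simp [hGa (r - σ) (by linarith)]
  · intro r hr
    simp [hGb (r - σ) (by linarith), hI0.ne']
  · intro r hr
    have h := (((hGd (r - σ)).comp_sub_const r σ).div_const I).const_sub 1
    rw [h.deriv, abs_neg, abs_of_nonneg (div_nonneg (hg0 _) hI0.le)]
    exact (div_le_self (hg0 _) hI1).trans (hgle _ (sub_pos.2 hr))
end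

section
/- Let σ, L, γ, C₀ > 0 and ε ∈ (0,1), set δ = exp(−1/ε), and assume δ ≤ σ ≤ 1. Let ṽ : (σ, ∞) → ℝ be a measurable function with ṽ(r) = 0 for all r ≥ σ + δ + δ²/2 and |ṽ(r)| ≤ C₀·(ε/(r − σ) + γ/(2πr)) for σ < r < σ + δ + δ²/2. Then there exists a constant C > 0, depending only on C₀ and γ (and in particular independent of σ, ε, δ, L), such that for every function v : [σ, ∞) × [0, L] → ℝ that is continuously differentiable, satisfies v(σ, z) = 0 for all z ∈ [0, L], and has ∫₀^L ∫_σ^∞ (∂v/∂r)(r,z)² · r dr dz < ∞, one has (∫₀^L ∫_σ^∞ v(r,z)² · ṽ(r)² · r dr dz)^{1/2} ≤ C·(ε + δ/σ)·(∫₀^L ∫_σ^∞ (∂v/∂r)(r,z)² · r dr dz)^{1/2}. -/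
open MeasureTheory

/-- One-dimensional Hardy inequality in the form needed on each slice. -/
lemma hardy_slice (σ R A : ℝ) (hσ : 0 < σ) (hR : σ < R) (hR2 : R ≤ 5 / 2 * σ) (hA : 0 < A)
    (f b : ℝ → ℝ) (hf : DifferentiableOn ℝ f (Set.Ici σ)) (hf0 : f σ = 0)
    (hb0 : ∀ r, R ≤ r → b r = 0)
    (hb : ∀ r, σ < r → r < R → |b r| ≤ A / (r - σ))
    (hF : IntegrableOn (fun r => f r ^ 2 * b r ^ 2 * r) (Set.Ioi σ))
    (hG : IntegrableOn (fun r => deriv f r ^ 2 * r) (Set.Ioi σ)) :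
    ∫ r in Set.Ioi σ, f r ^ 2 * b r ^ 2 * r ≤
      10 * A ^ 2 * ∫ r in Set.Ioi σ, deriv f r ^ 2 * r := by
  have hd : ∀ x, σ < x → HasDerivAt f (deriv f x) x := fun x hx =>
    ((hf x hx.le).differentiableAt (Ici_mem_nhds hx)).hasDerivAt
  have hF' : IntegrableOn (fun r => f r ^ 2 * b r ^ 2 * r) (Set.Icc σ R) := by
    rw [integrableOn_Icc_iff_integrableOn_Ioc]
    exact hF.mono_set Set.Ioc_subset_Ioi_self
  have hG' : IntegrableOn (fun r => deriv f r ^ 2 * r) (Set.Icc σ R) := by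
    rw [integrableOn_Icc_iff_integrableOn_Ioc]
    exact hG.mono_set Set.Ioc_subset_Ioi_self
  have hcont : ContinuousOn (fun x => f x ^ 2 / (x - σ)) (Set.Icc σ R) := by
    intro x hx
    rcases eq_or_lt_of_le hx.1 with h | h
    · subst h
      have h1 := (hf σ Set.self_mem_Ici).hasDerivWithinAt
      rw [hasDerivWithinAt_iff_tendsto_slope] at h1
      have h2 : Filter.Tendsto f (nhdsWithin σ (Set.Ici σ \ {σ})) (nhds 0) := by
        have := (hf σ Set.self_mem_Ici).continuousWithinAt.tendsto
        rw [hf0] at this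
        exact this.mono_left (nhdsWithin_mono _ Set.sdiff_subset)
      have h3 := h2.mul h1
      rw [zero_mul] at h3
      have h4 : ContinuousWithinAt (fun x => f x ^ 2 / (x - σ)) (Set.Ici σ) σ := by
        rw [← continuousWithinAt_sdiff_self]
        unfold ContinuousWithinAt
        simp only [sub_self, div_zero]
        refine h3.congr fun y => ?_
        rw [slope_def_field, hf0]
        ring
      exact h4.mono Set.Icc_subset_Ici_self
    · have := (hd x h).continuousAt
      have hne : x - σ ≠ 0 := by linarith
      exact ((this.pow 2).div (continuousAt_id.sub continuousAt_const) hne).continuousWithinAt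
  have key := intervalIntegral.sub_le_integral_of_hasDeriv_right_of_le (a := σ) (b := R)
    (g := fun x => f x ^ 2 / (x - σ))
    (g' := fun x => (2 * f x * deriv f x * (x - σ) - f x ^ 2) / (x - σ) ^ 2)
    (φ := fun x => (2 / σ) * (deriv f x ^ 2 * x) - (1 / (5 * σ * A ^ 2)) * (f x ^ 2 * b x ^ 2 * x))
    hR.le hcont ?_ ?_ ?_
  · have e1 : ∫ r in Set.Ioi σ, f r ^ 2 * b r ^ 2 * r = ∫ r in σ..R, f r ^ 2 * b r ^ 2 * r := by
      rw [intervalIntegral.integral_of_le hR.le]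
      refine setIntegral_eq_of_subset_of_forall_sdiff_eq_zero measurableSet_Ioi
        Set.Ioc_subset_Ioi_self ?_
      intro x hx
      have : R ≤ x := by
        by_contra h
        exact hx.2 ⟨hx.1, (not_le.mp h).le⟩
      simp [hb0 x this]
    have e2 : ∫ r in σ..R, deriv f r ^ 2 * r ≤ ∫ r in Set.Ioi σ, deriv f r ^ 2 * r := by
      rw [intervalIntegral.integral_of_le hR.le]
      refine setIntegral_mono_set hG ?_ (Filter.Eventually.of_forall Set.Ioc_subset_Ioi_self)
      refine (ae_restrict_iff' measurableSet_Ioi).2 (Filter.Eventually.of_forall fun x hx => ?_)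
      have hx' : 0 < x := hσ.trans hx
      simp only [Pi.zero_apply]
      positivity
    have i1 : IntervalIntegrable (fun r => f r ^ 2 * b r ^ 2 * r) volume σ R :=
      (intervalIntegrable_iff_integrableOn_Icc_of_le hR.le).2 hF'
    have i2 : IntervalIntegrable (fun r => deriv f r ^ 2 * r) volume σ R :=
      (intervalIntegrable_iff_integrableOn_Icc_of_le hR.le).2 hG'
    rw [intervalIntegral.integral_sub (i2.const_mul _) (i1.const_mul _),
      intervalIntegral.integral_const_mul, intervalIntegral.integral_const_mul] at key
    have hw : 0 ≤ f R ^ 2 / (R - σ) := div_nonneg (sq_nonneg _) (by linarith)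
    simp only [sub_self, div_zero, sub_zero] at key
    rw [e1]
    refine le_trans ?_ (mul_le_mul_of_nonneg_left e2 (by positivity))
    set X := ∫ r in σ..R, f r ^ 2 * b r ^ 2 * r
    set Y := ∫ r in σ..R, deriv f r ^ 2 * r
    have k1 : 1 / (5 * σ * A ^ 2) * X ≤ 2 / σ * Y := by linarith
    have k2 := mul_le_mul_of_nonneg_left k1 (by positivity : 0 ≤ 5 * σ * A ^ 2)
    have k3 : 5 * σ * A ^ 2 * (1 / (5 * σ * A ^ 2) * X) = X := by field_simp
    have k4 : 5 * σ * A ^ 2 * (2 / σ * Y) = 10 * A ^ 2 * Y := by field_simp; ring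
    linarith
  · intro x hx
    have hne : x - σ ≠ 0 := by linarith [hx.1]
    refine HasDerivAt.hasDerivWithinAt ?_
    refine (((hd x hx.1).pow 2).div ((hasDerivAt_id x).sub_const σ) hne).congr_deriv ?_
    simp
  · exact (hG'.const_mul _).sub (hF'.const_mul _)
  · intro x hx
    have ht : 0 < x - σ := by linarith [hx.1]
    have hx0 : 0 < x := hσ.trans hx.1
    have hbx := hb x hx.1 hx.2
    have hb2 : b x ^ 2 ≤ A ^ 2 / (x - σ) ^ 2 := by
      rw [← div_pow, ← sq_abs (b x)]
      exact pow_le_pow_left₀ (abs_nonneg _) hbx 2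
    set q := f x / (x - σ) with hq
    have hfq : f x = q * (x - σ) := by rw [hq]; field_simp
    have a1 : (2 * f x * deriv f x * (x - σ) - f x ^ 2) / (x - σ) ^ 2
        = 2 * q * deriv f x - q ^ 2 := by
      rw [hfq]; field_simp
    have a2 : 1 / (5 * σ * A ^ 2) * (f x ^ 2 * b x ^ 2 * x) ≤ q ^ 2 / 2 := by
      have : f x ^ 2 * b x ^ 2 * x ≤ f x ^ 2 * (A ^ 2 / (x - σ) ^ 2) * (5 / 2 * σ) := by
        have : x ≤ 5 / 2 * σ := hx.2.le.trans hR2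
        gcongr
      calc _ ≤ 1 / (5 * σ * A ^ 2) * (f x ^ 2 * (A ^ 2 / (x - σ) ^ 2) * (5 / 2 * σ)) := by
            gcongr
        _ = q ^ 2 / 2 := by rw [hfq]; field_simp; try norm_num
    have a3 : 2 * deriv f x ^ 2 ≤ 2 / σ * (deriv f x ^ 2 * x) := by
      have : 1 ≤ x / σ := by rw [le_div_iff₀ hσ]; linarith [hx.1]
      calc 2 * deriv f x ^ 2 ≤ 2 * deriv f x ^ 2 * (x / σ) :=
            le_mul_of_one_le_right (by positivity) this
        _ = _ := by ring
    simp only [a1]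
    nlinarith [sq_nonneg (q - 2 * deriv f x)]



/-- The key estimate `‖v vb‖_{L²(r dr dz)} ≤ C (ε + δ/σ) ‖∂_r v‖_{L²(r dr dz)}` for the
Hopf background swirl `vb` supported in the thin annulus `σ < r < σ + δ + δ²/2`,
`δ = exp (-1/ε)`, with a constant `C` depending only on `C₀` and `γ`. -/
theorem hopf_swirl_interaction_estimate (C₀ γ : ℝ) (hC₀ : 0 < C₀) (hγ : 0 < γ) :
    ∃ C > (0 : ℝ), ∀ (σ L ε δ : ℝ), 0 < σ → 0 < L → 0 < ε → ε < 1 →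
      δ = Real.exp (-1 / ε) → δ ≤ σ → σ ≤ 1 →
      ∀ vb : ℝ → ℝ, Measurable vb →
        (∀ r, σ + δ + δ ^ 2 / 2 ≤ r → vb r = 0) →
        (∀ r, σ < r → r < σ + δ + δ ^ 2 / 2 →
          |vb r| ≤ C₀ * (ε / (r - σ) + γ / (2 * Real.pi * r))) →
      ∀ v : ℝ → ℝ → ℝ,
        ContDiffOn ℝ 1 (fun p : ℝ × ℝ => v p.1 p.2) (Set.Ici σ ×ˢ Set.Icc 0 L) →
        (∀ z ∈ Set.Icc (0 : ℝ) L, v σ z = 0) →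
        IntegrableOn (fun p : ℝ × ℝ => (deriv (fun r => v r p.2) p.1) ^ 2 * p.1)
          (Set.Ioi σ ×ˢ Set.Ioc 0 L) →
        Real.sqrt (∫ p in Set.Ioi σ ×ˢ Set.Ioc (0 : ℝ) L,
            (v p.1 p.2) ^ 2 * (vb p.1) ^ 2 * p.1) ≤
          C * (ε + δ / σ) *
            Real.sqrt (∫ p in Set.Ioi σ ×ˢ Set.Ioc (0 : ℝ) L,
              (deriv (fun r => v r p.2) p.1) ^ 2 * p.1) := by
  refine ⟨4 * (C₀ * (1 + γ)), by positivity, ?_⟩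
  intro σ L ε δ hσ hL hε hε1 hδ hδσ hσ1 vb hvb hvb0 hvbb v hv hv0 hint
  have hδ0 : 0 < δ := hδ ▸ Real.exp_pos _
  have hδ1 : δ ≤ 1 := hδσ.trans hσ1
  set A := C₀ * (1 + γ) * (ε + δ / σ) with hA
  have hA0 : 0 < A := by positivity
  have hw : δ + δ ^ 2 / 2 ≤ 3 / 2 * δ := by nlinarith
  have hb : ∀ r, σ < r → r < σ + δ + δ ^ 2 / 2 → |vb r| ≤ A / (r - σ) := by
    intro r h1 h2
    refine (hvbb r h1 h2).trans ?_
    have ht : 0 < r - σ := by linarith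
    have hr : 0 < r := hσ.trans h1
    have hg : γ / (2 * Real.pi * r) ≤ γ * (δ / σ) / (r - σ) := by
      have e : γ * (δ / σ) / (r - σ) = γ * δ / (σ * (r - σ)) := by field_simp
      rw [e, div_le_div_iff₀ (by positivity) (by positivity)]
      have hpi := Real.pi_gt_three
      have s1 : σ * (r - σ) ≤ r * (3 / 2 * δ) := by
        apply mul_le_mul h1.le (by linarith) ht.le hr.le
      have s2 : r * (3 / 2 * δ) ≤ δ * (2 * Real.pi * r) := by
        nlinarith [mul_pos hr hδ0]
      calc γ * (σ * (r - σ)) ≤ γ * (δ * (2 * Real.pi * r)) := by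
            exact mul_le_mul_of_nonneg_left (s1.trans s2) hγ.le
        _ = _ := by ring
    have hfin : C₀ * (ε / (r - σ) + γ * (δ / σ) / (r - σ)) ≤ A / (r - σ) := by
      rw [← add_div, ← mul_div_assoc, hA, mul_assoc]
      have : 0 < δ / σ := by positivity
      have : ε + γ * (δ / σ) ≤ (1 + γ) * (ε + δ / σ) := by nlinarith [mul_pos hγ hε]
      gcongr
    refine le_trans ?_ hfin
    gcongr
  have main : ∫ p in Set.Ioi σ ×ˢ Set.Ioc (0 : ℝ) L, (v p.1 p.2) ^ 2 * (vb p.1) ^ 2 * p.1 ≤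
      10 * A ^ 2 * ∫ p in Set.Ioi σ ×ˢ Set.Ioc (0 : ℝ) L,
        (deriv (fun r => v r p.2) p.1) ^ 2 * p.1 := by
    by_cases hF : IntegrableOn (fun p : ℝ × ℝ => (v p.1 p.2) ^ 2 * (vb p.1) ^ 2 * p.1)
        (Set.Ioi σ ×ˢ Set.Ioc 0 L)
    · unfold IntegrableOn at hF hint
      rw [Measure.volume_eq_prod, ← Measure.prod_restrict] at hF hint ⊢
      rw [integral_prod_symm _ hF, integral_prod_symm _ hint, ← integral_const_mul]
      refine integral_mono_ae hF.integral_prod_right (hint.integral_prod_right.const_mul _) ?_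
      filter_upwards [hF.prod_left_ae, hint.prod_left_ae, ae_restrict_mem measurableSet_Ioc]
        with z h1 h2 hz
      have hz' : z ∈ Set.Icc 0 L := Set.Ioc_subset_Icc_self hz
      refine hardy_slice σ (σ + δ + δ ^ 2 / 2) A hσ (by nlinarith) (by linarith) hA0
        (fun r => v r z) vb ?_ (hv0 z hz') hvb0 hb h1 h2
      have hd := hv.differentiableOn one_ne_zero
      exact hd.comp (g := fun p : ℝ × ℝ => v p.1 p.2) (f := fun r => (r, z)) (by fun_prop)
        (fun r hr => ⟨hr, hz'⟩)
    · rw [integral_undef hF]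
      refine mul_nonneg (by positivity) (setIntegral_nonneg
        (measurableSet_Ioi.prod measurableSet_Ioc) fun p hp => ?_)
      have : 0 < p.1 := hσ.trans hp.1
      positivity
  refine (Real.sqrt_le_sqrt main).trans ?_
  rw [Real.sqrt_mul (by positivity)]
  refine mul_le_mul_of_nonneg_right ?_ (Real.sqrt_nonneg _)
  rw [Real.sqrt_le_left (by positivity)]
  have : 4 * (C₀ * (1 + γ)) * (ε + δ / σ) = 4 * A := by rw [hA]; ring
  rw [this]
  nlinarith [sq_nonneg A]
end

section
/- Let 0 < σ < R, L > 0, ρ > 0 and γ ≠ 0. Let v : (σ, R) × (0, L) → ℝ be a continuous function such that for every r ∈ (σ, R) one has v(r, z) → 0 as z → 0⁺, and for every z ∈ (0, L) one has v(r, z) → γ/(2πσ) as r → σ⁺. Then there exists no differentiable function p : (σ, R) × (0, L) → ℝ satisfying ∂p/∂z(r, z) = 0 and ∂p/∂r(r, z) = ρ·v(r, z)²/r for all (r, z) ∈ (σ, R) × (0, L). -/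
/-- No cyclostrophic pressure: there is no differentiable `p` on the rectangle
`(σ, R) × (0, L)` with `∂_z p = 0` and `∂_r p = ρ v² / r`, where `v` is continuous,
tends to `0` as `z → 0⁺` and to `γ/(2πσ)` as `r → σ⁺`. -/
theorem no_cyclostrophic_pressure (σ R L ρ γ : ℝ) (hσ : 0 < σ) (hσR : σ < R)
    (hL : 0 < L) (hρ : 0 < ρ) (hγ : γ ≠ 0) (v : ℝ → ℝ → ℝ)
    (hcont : ContinuousOn (fun q : ℝ × ℝ => v q.1 q.2) (Set.Ioo σ R ×ˢ Set.Ioo 0 L))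
    (hz : ∀ r ∈ Set.Ioo σ R,
      Filter.Tendsto (fun z => v r z) (nhdsWithin 0 (Set.Ioi 0)) (nhds 0))
    (hr : ∀ z ∈ Set.Ioo (0 : ℝ) L,
      Filter.Tendsto (fun r => v r z) (nhdsWithin σ (Set.Ioi σ))
        (nhds (γ / (2 * Real.pi * σ)))) :
    ¬ ∃ p : ℝ → ℝ → ℝ,
        DifferentiableOn ℝ (fun q : ℝ × ℝ => p q.1 q.2) (Set.Ioo σ R ×ˢ Set.Ioo 0 L) ∧
        ∀ r ∈ Set.Ioo σ R, ∀ z ∈ Set.Ioo (0 : ℝ) L,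
          HasDerivAt (fun t => p r t) 0 z ∧
          HasDerivAt (fun s => p s z) (ρ * (v r z) ^ 2 / r) r := by
  rintro ⟨p, -, hp⟩
  have hpc : ∀ r ∈ Set.Ioo σ R, ∀ z ∈ Set.Ioo (0 : ℝ) L, ∀ z' ∈ Set.Ioo (0 : ℝ) L,
      p r z = p r z' := by
    intro r hrr z hzz z' hzz'
    refine (isOpen_Ioo (a := (0 : ℝ)) (b := L)).is_const_of_deriv_eq_zero
      (f := fun t => p r t) (convex_Ioo (0 : ℝ) L).isPreconnected ?_ ?_ hzz hzz'
    · intro t ht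
      exact (hp r hrr t ht).1.differentiableAt.differentiableWithinAt
    · intro t ht
      exact (hp r hrr t ht).1.deriv
  have hvc : ∀ r ∈ Set.Ioo σ R, ∀ z ∈ Set.Ioo (0 : ℝ) L, ∀ z' ∈ Set.Ioo (0 : ℝ) L,
      (v r z) ^ 2 = (v r z') ^ 2 := by
    intro r hrr z hzz z' hzz'
    have h1 := (hp r hrr z hzz).2
    have h2 := (hp r hrr z' hzz').2
    have he : (fun s => p s z') =ᶠ[nhds r] (fun s => p s z) := by
      filter_upwards [Ioo_mem_nhds hrr.1 hrr.2] with s hs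
      exact hpc s hs z' hzz' z hzz
    have h3 := h1.unique (h2.congr_of_eventuallyEq he.symm)
    have hr0 : r ≠ 0 := (hσ.trans hrr.1).ne'
    field_simp at h3
    exact h3
  have hv0 : ∀ r ∈ Set.Ioo σ R, ∀ z ∈ Set.Ioo (0 : ℝ) L, v r z = 0 := by
    intro r hrr z hzz
    have h1 := (hz r hrr).pow 2
    have h2 : Filter.Tendsto (fun t => (v r t) ^ 2) (nhdsWithin 0 (Set.Ioi 0))
        (nhds ((v r z) ^ 2)) := by
      refine tendsto_const_nhds.congr' ?_
      filter_upwards [Ioo_mem_nhdsGT hL] with t ht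
      exact hvc r hrr z hzz t ht
    have h3 := tendsto_nhds_unique h2 h1
    simpa using h3
  have hm : L / 2 ∈ Set.Ioo (0 : ℝ) L := ⟨by linarith, by linarith⟩
  have h2 : Filter.Tendsto (fun r => v r (L / 2)) (nhdsWithin σ (Set.Ioi σ)) (nhds 0) := by
    refine tendsto_const_nhds.congr' ?_
    filter_upwards [Ioo_mem_nhdsGT hσR] with r hrr
    exact (hv0 r hrr _ hm).symm
  have h3 := tendsto_nhds_unique (hr _ hm) h2
  have hpi := Real.pi_pos
  exact (div_ne_zero hγ (by positivity)) h3
end
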